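/- arXiv:1705.04630 — 3 statements merged into one kernel-verified Lean document; each statement's English description precedes it below -/
import Mathlib

section
/- Let μ* ∈ P(O^ω), let S be a μ*-prudent gambling strategy, and let F be a forecaster that dominates the gambler PG S. Then for μ*-almost every x ∈ O^ω: Σ_{n=0}^∞ (E_{μ*}[S_n(x_{:n}; F_n(x_{:n})) | x_{:n}O^ω] − E_{F_n(x_{:n})}[S_n(x_{:n}; F_n(x_{:n}))]) < +∞, where S_n(y;μ) := S_n(y)(μ) ∈ C(O^ω) and E_{μ*}[· | x_{:n}O^ω] denotes regular conditional expectation given pr_n = x_{:n}. -/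
open MeasureTheory Filter Set Topology
open scoped NNReal ENNReal

noncomputable section

/-- The completion of the ambient σ-algebra with respect to a measure `μ`:
the σ-algebra of `μ`-null-measurable sets. -/
def completionMS {Y : Type*} [MeasurableSpace Y] (μ : Measure Y) : MeasurableSpace Y where
  MeasurableSet' s := NullMeasurableSet s μ
  measurableSet_empty := MeasurableSet.empty.nullMeasurableSet
  measurableSet_compl := fun _ h => h.compl
  measurableSet_iUnion := fun _ h => NullMeasurableSet.iUnion h

/-- The σ-algebra of universally measurable sets: the intersection of the completions
of the ambient (Borel) σ-algebra with respect to all probability measures. -/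
def univMS (Y : Type*) [MeasurableSpace Y] : MeasurableSpace Y :=
  ⨅ (μ : Measure Y) (_ : IsProbabilityMeasure μ), completionMS μ

/-- The support of a probability measure: the set of points all of whose open
neighbourhoods have positive measure. -/
def msupp {X : Type*} [TopologicalSpace X] [MeasurableSpace X] (μ : ProbabilityMeasure X) :
    Set X :=
  {x | ∀ U : Set X, IsOpen U → x ∈ U → 0 < μ.toMeasure U}

/-- `ρ` is a metrization of the topological space `X`: it is a metric and the
neighbourhood filters are generated by its open balls. -/
structure IsMetrization {X : Type*} [TopologicalSpace X] (ρ : X → X → ℝ) : Prop where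
  refl : ∀ x, ρ x x = 0
  pos : ∀ x y, x ≠ y → 0 < ρ x y
  symm : ∀ x y, ρ x y = ρ y x
  triangle : ∀ x y z, ρ x z ≤ ρ x y + ρ y z
  nhds_basis : ∀ x : X, (nhds x).HasBasis (fun ε : ℝ => 0 < ε) (fun ε => {y | ρ x y < ε})

/-- `f` is Lipschitz with respect to the metric `ρ`. -/
def LipWrt {X : Type*} (ρ : X → X → ℝ) (f : X → ℝ) : Prop :=
  ∃ K : ℝ, ∀ x y, |f x - f y| ≤ K * ρ x y

/-- The norm `‖f‖_ρ := max_x |f x| + sup_{x ≠ y} |f x - f y| / ρ x y` on Lipschitz functions. -/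
def lipNorm {X : Type*} (ρ : X → X → ℝ) (f : X → ℝ) : ℝ :=
  (⨆ x, |f x|) + sSup {c | ∃ x y, x ≠ y ∧ c = |f x - f y| / ρ x y}

/-- The Kantorovich-Rubinstein distance
`D^ρ(μ, ν) := sup {E_μ[f] - E_ν[f] | f Lipschitz, ‖f‖_ρ ≤ 1}`. -/
def KRdist {X : Type*} [MeasurableSpace X] (ρ : X → X → ℝ) (μ ν : ProbabilityMeasure X) : ℝ :=
  sSup {c | ∃ f : X → ℝ, LipWrt ρ f ∧ lipNorm ρ f ≤ 1 ∧
    c = (∫ x, f x ∂(μ : Measure X)) - ∫ x, f x ∂(ν : Measure X)}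

/-- The Kantorovich-Rubinstein distance from a measure to a set of measures. -/
def KRdistSet {X : Type*} [MeasurableSpace X] (ρ : X → X → ℝ) (μ : ProbabilityMeasure X)
    (A : Set (ProbabilityMeasure X)) : ℝ :=
  sInf {c | ∃ ν ∈ A, c = KRdist ρ μ ν}

/-- Convexity for a set of probability measures. -/
def ConvexPM {X : Type*} [MeasurableSpace X] (A : Set (ProbabilityMeasure X)) : Prop :=
  ∀ μ ∈ A, ∀ ν ∈ A, ∀ p : ℝ≥0, p ≤ 1 → ∀ ξ : ProbabilityMeasure X,
    (ξ : Measure X) = p • (μ : Measure X) + (1 - p) • (ν : Measure X) → ξ ∈ A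

/-- `κ` is a regular conditional probability for `μ` given `π`: it is a measurable family
of probability measures which disintegrates `μ` over `π_* μ` and is concentrated on fibers. -/
def IsRCP {X Y : Type*} [MeasurableSpace X] [MeasurableSpace Y]
    (μ : Measure X) (π : X → Y) (κ : Y → ProbabilityMeasure X) : Prop :=
  Measurable (fun y => (κ y : Measure X)) ∧
  (∀ s : Set X, MeasurableSet s → ∀ t : Set Y, MeasurableSet t →
    μ (s ∩ π ⁻¹' t) = ∫⁻ y in t, (κ y : Measure X) s ∂(μ.map π)) ∧
  (∀ᵐ y ∂(μ.map π), (κ y : Measure X) (π ⁻¹' {y}) = 1)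

/-- `N` is a regular upper bound for `M | π` (Definition 2.2 of the paper). -/
structure IsRUB {X Y : Type*} [TopologicalSpace X] [TopologicalSpace Y]
    [MeasurableSpace X] [MeasurableSpace Y] [OpensMeasurableSpace X]
    (π : X → Y) (M : Set (ProbabilityMeasure X)) (N : Y → Set (ProbabilityMeasure X)) : Prop where
  closed : IsClosed {p : Y × ProbabilityMeasure X | p.2 ∈ N p.1}
  convex : ∀ y, ConvexPM (N y)
  cond : ∀ μ ∈ M, ∀ κ : Y → ProbabilityMeasure X, IsRCP (μ : Measure X) π κ →
    ∀ᵐ y ∂((μ : Measure X).map π), κ y ∈ N y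

/-- `β` is an `(M, r₀)`-savvy bet (with respect to the metric `ρ`). -/
def IsSavvy {X : Type*} [TopologicalSpace X] [MeasurableSpace X] [OpensMeasurableSpace X]
    (ρ : X → X → ℝ) (M : Set (ProbabilityMeasure X)) (r₀ : ℝ)
    (β : ProbabilityMeasure X × X → ℝ) : Prop :=
  Continuous β ∧
  ∀ μ : ProbabilityMeasure X,
    (∀ x, |β (μ, x)| ≤ max (KRdistSet ρ μ M - r₀) 0) ∧
    ∀ ν ∈ M, (1/2) * (KRdistSet ρ μ M - r₀) * KRdistSet ρ μ M ≤
      (∫ x, β (μ, x) ∂(ν : Measure X)) - ∫ x, β (μ, x) ∂(μ : Measure X)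

/-- Borel σ-algebra on the space of probability measures (with its weak topology). -/
instance {X : Type*} [TopologicalSpace X] [MeasurableSpace X] [OpensMeasurableSpace X] :
    MeasurableSpace (ProbabilityMeasure X) := borel _

/-- Borel σ-algebra on a space of continuous functions. -/
instance {Y : Type*} [TopologicalSpace Y] : MeasurableSpace C(Y, ℝ) := borel _

end
noncomputable section

variable (O : ℕ → Type*) [∀ n, TopologicalSpace (O n)] [∀ n, CompactSpace (O n)]
  [∀ n, PolishSpace (O n)] [∀ n, MeasurableSpace (O n)] [∀ n, BorelSpace (O n)]

/-- The space `O^n` of observation histories of length `n`. -/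
abbrev Hn (n : ℕ) : Type _ := ∀ i : Fin n, O i

/-- The space `O^ω` of infinite observation sequences. -/
abbrev Hw : Type _ := ∀ n : ℕ, O n

/-- The projection `O^ω → O^n`, `x ↦ x_{:n}`. -/
def proj (n : ℕ) : Hw O → Hn O n := fun x i => x i

/-- The cylinder `yO^ω` over `y ∈ O^n`. -/
def cyl (n : ℕ) (y : Hn O n) : Set (Hw O) := {x | proj O n x = y}

/-- Truncation `O^n → O^m` for `m ≤ n`. -/
def trunc {m n : ℕ} (h : m ≤ n) (y : Hn O n) : Hn O m := fun i => y (i.castLE h)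

/-- The payoff `(Vβ)(μ, x) := β(μ, x) - E_{x' ∼ μ}[β(μ, x')]` of a bet `β`. -/
def Vbet {X : Type*} [MeasurableSpace X]
    (β : ProbabilityMeasure X × X → ℝ) (μ : ProbabilityMeasure X) (x : X) : ℝ :=
  β (μ, x) - ∫ x', β (μ, x') ∂(μ : Measure X)

/-- The sup norm of a bet. -/
def gmNorm {X : Type*} [MeasurableSpace X] (β : ProbabilityMeasure X × X → ℝ) : ℝ :=
  ⨆ p, |β p|

/-- A forecaster: a family of measurable maps `F_n : O^n → P(O^ω)` (with `O^n` carrying the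
σ-algebra of universally measurable sets), whose forecasts are supported on the observed
cylinder. -/
structure Forecaster where
  F : ∀ n, Hn O n → ProbabilityMeasure (Hw O)
  measurable : ∀ n, @Measurable _ _ (univMS (Hn O n)) inferInstance (F n)
  supp : ∀ n y, msupp (F n y) ⊆ cyl O n y

/-- The (not necessarily continuous or measurable) data of a gambler: for each `n`, a map
assigning to an observation history and a forecast history a bet. -/
abbrev PreGambler : Type _ := ∀ n : ℕ, Hn O n × (Fin n → ProbabilityMeasure (Hw O)) →
  ProbabilityMeasure (Hw O) × Hw O → ℝ

/-- A gambler: a family of measurable maps `G_n : O^n × P(O^ω)^n → Gm(O^ω)`, where `O^n`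
carries the universally measurable σ-algebra, `P(O^ω)^n` the Borel σ-algebra, and the space
`Gm(O^ω) = C(P(O^ω) × O^ω)` of bets the Borel σ-algebra. -/
structure Gambler where
  G : ∀ n : ℕ, Hn O n × (Fin n → ProbabilityMeasure (Hw O)) →
    C(ProbabilityMeasure (Hw O) × Hw O, ℝ)
  measurable : ∀ n, @Measurable _ _ (MeasurableSpace.prod (univMS (Hn O n)) inferInstance)
    inferInstance (G n)

/-- The underlying bet-valued data of a gambler. -/
def Gambler.pre (G : Gambler O) : PreGambler O := fun n yμ p => G.G n yμ p

/-- The forecast history of a forecaster along an observation history. -/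
def fhist (F : ∀ n, Hn O n → ProbabilityMeasure (Hw O)) (n : ℕ) (y : Hn O n) :
    Fin n → ProbabilityMeasure (Hw O) := fun m => F m (trunc O m.isLt.le y)

/-- The total payoff `SV G_n(y, μ̄)(x)` of the first `n` gambles of a gambler `G`,
given forecasts `μ̄` (here `y ∈ O^{n-1}`). -/
def SVg (G : PreGambler O) (n : ℕ) (y : Hn O (n-1))
    (μs : Fin n → ProbabilityMeasure (Hw O)) (x : Hw O) : ℝ :=
  ∑ m : Fin n, Vbet (G m (trunc O (Nat.le_pred_of_lt m.isLt) y,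
      fun i : Fin m => μs (i.castLE m.isLt.le)))
    (μs m) x

/-- The minimal total payoff `SVmin G_n(y, μ̄)` over the cylinder `yO^ω`. -/
def SVgMin (G : PreGambler O) (n : ℕ) (y : Hn O (n-1))
    (μs : Fin n → ProbabilityMeasure (Hw O)) : ℝ :=
  sInf (SVg O G n y μs '' cyl O (n-1) y)

/-- The maximal total payoff `SVmax G_n(y, μ̄)` over the cylinder `yO^ω`. -/
def SVgMax (G : PreGambler O) (n : ℕ) (y : Hn O (n-1))
    (μs : Fin n → ProbabilityMeasure (Hw O)) : ℝ :=
  sSup (SVg O G n y μs '' cyl O (n-1) y)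

/-- The total payoff `SV G^F_n(x)` of the first `n` gambles of a gambler `G` playing
against a forecaster `F`, along the observation sequence `x`. -/
def SVf (G : PreGambler O) (F : ∀ n, Hn O n → ProbabilityMeasure (Hw O)) (n : ℕ)
    (x : Hw O) : ℝ :=
  ∑ m : Fin n, Vbet (G m (proj O m x, fhist O F m (proj O m x))) (F m (proj O m x)) x

/-- The minimal total payoff `SVmin G^F_n(y)` over the cylinder `yO^ω`, `y ∈ O^{n-1}`. -/
def SVfMin (G : PreGambler O) (F : ∀ n, Hn O n → ProbabilityMeasure (Hw O)) (n : ℕ)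
    (y : Hn O (n-1)) : ℝ :=
  sInf (SVf O G F n '' cyl O (n-1) y)

/-- The maximal total payoff `SVmax G^F_n(y)` over the cylinder `yO^ω`, `y ∈ O^{n-1}`. -/
def SVfMax (G : PreGambler O) (F : ∀ n, Hn O n → ProbabilityMeasure (Hw O)) (n : ℕ)
    (y : Hn O (n-1)) : ℝ :=
  sSup (SVf O G F n '' cyl O (n-1) y)

/-- A forecaster (given by its family of forecasts) dominates a gambler when, along every
observation sequence, if the gambler's minimal total payoff is bounded below then its
maximal total payoff is bounded above. -/
def Dominates (F : ∀ n, Hn O n → ProbabilityMeasure (Hw O)) (G : PreGambler O) : Prop :=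
  ∀ x : Hw O,
    BddBelow (Set.range fun n => SVfMin O G F n (proj O (n-1) x)) →
    BddAbove (Set.range fun n => SVfMax O G F n (proj O (n-1) x))

/-- A gambling strategy: a uniformly bounded family of measurable maps `S_n : O^n → Gm(O^ω)`
(not depending on the forecast history). -/
structure Strategy where
  S : ∀ n : ℕ, Hn O n → C(ProbabilityMeasure (Hw O) × Hw O, ℝ)
  measurable : ∀ n, @Measurable _ _ (univMS (Hn O n)) inferInstance (S n)
  bounded : ∃ C : ℝ, ∀ n y p, |S n y p| ≤ C

open scoped Classical in
/-- The gambler `PG S` associated to a gambling strategy `S`: it plays `S` in round `n`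
exactly when the uncertainty about the total payoff of previous bets is at most `1`. -/
def PGfun (S : Strategy O) : (n : ℕ) → Hn O n × (Fin n → ProbabilityMeasure (Hw O)) →
    C(ProbabilityMeasure (Hw O) × Hw O, ℝ)
  | n, yμ =>
    let sv : Hw O → ℝ := fun x =>
      ∑ m : Fin n, Vbet (fun p => PGfun S m
          (trunc O m.isLt.le yμ.1, fun i : Fin m => yμ.2 (i.castLE m.isLt.le)) p)
        (yμ.2 m) x
    if sSup (sv '' cyl O (n-1) (trunc O (Nat.sub_le n 1) yμ.1)) -
        sInf (sv '' cyl O (n-1) (trunc O (Nat.sub_le n 1) yμ.1)) ≤ 1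
    then S.S n yμ.1 else 0
termination_by n => n
decreasing_by exact m.isLt

/-- The gambler `PG S`, as gambling data. -/
def PGpre (S : Strategy O) : PreGambler O := fun n yμ p => PGfun O S n yμ p

/-- The normalization factor `Nr_b G_n(y, μ̄; ν)` used to enforce a finite budget `b`. -/
def NrFun (G : PreGambler O) (b : ℝ) (n : ℕ) (y : Hn O n)
    (μs : Fin n → ProbabilityMeasure (Hw O)) (ν : ProbabilityMeasure (Hw O)) : ℝ :=
  (max 1 (sSup ((fun x => (-(Vbet (G n (y, μs)) ν x)) /
      (SVg O G n (trunc O (Nat.sub_le n 1) y) μs x + b)) '' cyl O n y)))⁻¹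

open scoped Classical in
/-- The gambler `Bd_b G`: the modification of `G` which never loses more than the budget
`b`. -/
def BdG (G : PreGambler O) (b : ℝ) : PreGambler O := fun n yμ =>
  if ∀ m : Fin n, -b < SVgMin O G (m.1+1) (trunc O m.isLt.le yμ.1)
      (fun i : Fin (m.1+1) => yμ.2 (i.castLE m.isLt)) then
    fun p => NrFun O G b n yμ.1 yμ.2 p.1 * G n yμ p
  else fun _ => 0

/-- A gambling strategy `S` is `μ*`-prudent when, for some `α > 0`, for every round, almost
every observation history and every forecast, the expected payoff of the bet under the true
environment `μ*` exceeds the payoff under the forecast by at least `α` times the spread of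
the bet. -/
def IsPrudent (S : Strategy O) (μstar : ProbabilityMeasure (Hw O)) : Prop :=
  ∃ α : ℝ, 0 < α ∧ ∀ n : ℕ, ∀ κ : Hn O n → ProbabilityMeasure (Hw O),
    IsRCP (μstar : Measure (Hw O)) (proj O n) κ →
      ∀ᵐ y ∂((μstar : Measure (Hw O)).map (proj O n)), ∀ μ : ProbabilityMeasure (Hw O),
        α * (sSup ((fun x => S.S n y (μ, x)) '' cyl O n y) -
             sInf ((fun x => S.S n y (μ, x)) '' cyl O n y)) ≤
          (∫ x, S.S n y (μ, x) ∂(κ y : Measure (Hw O))) -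
            ∫ x, S.S n y (μ, x) ∂(μ : Measure (Hw O))

section UniversallyMeasurable

variable {Y Z : Type*} [MeasurableSpace Y] [MeasurableSpace Z]

theorem measurableSet_univMS_iff {s : Set Y} :
    MeasurableSet[univMS Y] s ↔ ∀ μ : Measure Y, IsProbabilityMeasure μ → NullMeasurableSet s μ := by
  unfold univMS
  simp_rw [MeasurableSpace.measurableSet_iInf]
  rfl

theorem le_univMS : (inferInstance : MeasurableSpace Y) ≤ univMS Y := fun _ hs =>
  measurableSet_univMS_iff.2 fun _ _ => hs.nullMeasurableSet

theorem Measurable.univMS_univMS {f : Y → Z} (hf : Measurable f) :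
    Measurable[univMS Y, univMS Z] f := by
  intro s hs
  rw [measurableSet_univMS_iff] at hs ⊢
  intro μ hμ
  exact (hs (μ.map f) (Measure.isProbabilityMeasure_map hf.aemeasurable)).preimage
    (hf.quasiMeasurePreserving μ)

theorem Measurable.univMS_left {f : Y → Z} (hf : Measurable f) : Measurable[univMS Y] f :=
  hf.mono le_univMS le_rfl

theorem aemeasurable_of_univMS [MeasurableSpace.CountablyGenerated Z] {f : Y → Z}
    (hf : Measurable[univMS Y] f) (μ : Measure Y) [hμ : IsProbabilityMeasure μ] :
    AEMeasurable f μ :=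
  NullMeasurable.aemeasurable fun _ hs => measurableSet_univMS_iff.1 (hf hs) μ hμ

end UniversallyMeasurable

section Pairing

variable {X : Type*} [TopologicalSpace X] [MeasurableSpace X]

instance [OpensMeasurableSpace X] : BorelSpace (ProbabilityMeasure X) := ⟨rfl⟩

instance : BorelSpace C(X, ℝ) := ⟨rfl⟩

theorem integrable_continuousMap [CompactSpace X] [OpensMeasurableSpace X]
    (μ : Measure X) [IsFiniteMeasure μ] (f : C(X, ℝ)) : Integrable f μ :=
  (BoundedContinuousFunction.mkOfCompact f).integrable μ

theorem measurable_integral_continuousMap [CompactSpace X] [T2Space X]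
    [SecondCountableTopology X] [BorelSpace X] {Y : Type*} [MeasurableSpace Y]
    {f : Y → C(X, ℝ)} (hf : Measurable f) {P : Y → ProbabilityMeasure X}
    (hP : ∀ g : C(X, ℝ), Measurable fun y => ∫ x, g x ∂(P y : Measure X)) :
    Measurable fun y => ∫ x, f y x ∂(P y : Measure X) := by
  have hcont (y : Y) : Continuous fun g : C(X, ℝ) => ∫ x, g x ∂(P y : Measure X) := by
    refine LipschitzWith.continuous (K := 1) (LipschitzWith.of_dist_le_mul fun g h => ?_)
    rw [dist_eq_norm, ← integral_sub (integrable_continuousMap _ g) (integrable_continuousMap _ h)]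
    refine (norm_integral_le_of_norm_le_const (C := dist g h) ?_).trans (by simp)
    exact ae_of_all _ fun x => (dist_eq_norm (g x) (h x)).symm.trans_le
      (ContinuousMap.dist_apply_le_dist x)
  exact (measurable_uncurry_of_continuous_of_measurable hcont hP).comp
    (hf.prodMk measurable_id)

theorem measurable_integral_continuousMap_of_measurable [CompactSpace X]
    [SecondCountableTopology X] [BorelSpace X] {Y : Type*} [MeasurableSpace Y]
    {P : Y → ProbabilityMeasure X} (hP : Measurable P) (g : C(X, ℝ)) :
    Measurable fun y => ∫ x, g x ∂(P y : Measure X) :=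
  (ProbabilityMeasure.continuous_integral_boundedContinuousFunction
    (BoundedContinuousFunction.mkOfCompact g)).measurable.comp hP

theorem measurable_integral_continuousMap_of_measurable_coe [BorelSpace X]
    {Y : Type*} [MeasurableSpace Y]
    {P : Y → ProbabilityMeasure X} (hP : Measurable fun y => (P y : Measure X)) (g : C(X, ℝ)) :
    Measurable fun y => ∫ x, g x ∂(P y : Measure X) := by
  let k : ProbabilityTheory.Kernel Y X := ⟨fun y => P y, hP⟩
  have : ProbabilityTheory.IsMarkovKernel k := ⟨fun y => inferInstanceAs
    (IsProbabilityMeasure (P y : Measure X))⟩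
  exact (StronglyMeasurable.integral_kernel_prod_right' (κ := k) (f := fun p : Y × X => g p.2)
    (g.continuous.measurable.comp measurable_snd).stronglyMeasurable).measurable

theorem measurable_curry_apply [CompactSpace X] [PolishSpace X] [BorelSpace X]
    {Y : Type*} [MeasurableSpace Y] {β : Y → C(ProbabilityMeasure X × X, ℝ)} (hβ : Measurable β)
    {P : Y → ProbabilityMeasure X} (hP : Measurable P) :
    Measurable fun y => (β y).curry (P y) := by
  let := TopologicalSpace.pseudoMetrizableSpacePseudoMetric (ProbabilityMeasure X)
  have : SecondCountableTopology (ProbabilityMeasure X) := inferInstance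
  have h : Continuous fun p : C(ProbabilityMeasure X × X, ℝ) × ProbabilityMeasure X =>
      p.1.curry p.2 :=
    (ContinuousMap.continuous_curry.comp continuous_fst).eval continuous_snd
  exact h.measurable.comp (hβ.prodMk hP)

end Pairing

section Drift

open Real

/-- If `U` is controlled by its mean `T ≥ 0` and `V` oscillates little, adding `U` to `V` decreases
the expectation of `exp (-c V)` by a definite proportion. -/
theorem integral_exp_neg_add_le {X : Type*} [MeasurableSpace X] (κ : Measure X)
    [IsProbabilityMeasure κ] {V U : X → ℝ} {c T K B D : ℝ} {A : Set X}
    (hV : Measurable V) (hU : Measurable U) (hA : ∀ᵐ x ∂κ, x ∈ A)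
    (hosc : ∀ x ∈ A, ∀ x' ∈ A, V x - V x' ≤ D)
    (hUT : ∀ x ∈ A, |U x| ≤ K * T) (hUB : ∀ x ∈ A, |U x| ≤ B) (hT : ∫ x, U x ∂κ = T)
    (hc : 0 < c) (hcB : c * B ≤ 1) (hT0 : 0 ≤ T)
    (hsmall : (exp (c * D) - 1) * K + c * B * K ≤ 1 / 2) :
    Integrable (fun x => exp (-c * V x)) κ ∧ Integrable (fun x => exp (-c * (V x + U x))) κ ∧
    ∫ x, exp (-c * (V x + U x)) ∂κ ≤ (1 - c / 2 * T) * ∫ x, exp (-c * V x) ∂κ := by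
  obtain ⟨x₀, hx₀⟩ : A.Nonempty := hA.exists
  have hB : 0 ≤ B := (abs_nonneg _).trans (hUB x₀ hx₀)
  have hD : 0 ≤ D := by simpa using hosc x₀ hx₀ x₀ hx₀
  have hWm : Measurable fun x => exp (-c * V x) := by fun_prop
  have hWi : Integrable (fun x => exp (-c * V x)) κ := by
    refine Integrable.of_bound hWm.aestronglyMeasurable (exp (c * D - c * V x₀)) ?_
    filter_upwards [hA] with x hx
    rw [norm_of_nonneg (exp_pos _).le]
    gcongr
    nlinarith [hosc x₀ hx₀ x hx]
  have hbd (f : X → ℝ) (hf : Measurable f) (C : ℝ) (hfC : ∀ x ∈ A, |f x| ≤ C) :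
      Integrable (fun x => exp (-c * V x) * f x) κ := by
    refine hWi.mul_bdd (c := C) hf.aestronglyMeasurable ?_
    filter_upwards [hA] with x hx using hfC x hx
  have hexpU : ∀ x ∈ A, |exp (-c * U x)| ≤ exp 1 := by
    intro x hx
    rw [abs_of_pos (exp_pos _)]
    gcongr
    nlinarith [(abs_le.1 (hUB x hx)).1]
  have hsum : (fun x => exp (-c * (V x + U x))) = fun x => exp (-c * V x) * exp (-c * U x) := by
    ext x; rw [← exp_add]; ring_nf
  have hWU : Integrable (fun x => exp (-c * (V x + U x))) κ := by
    rw [hsum]; exact hbd _ (by fun_prop) _ hexpU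
  refine ⟨hWi, hWU, ?_⟩
  set Z := ∫ x, exp (-c * V x) ∂κ with hZ
  have hZ0 : 0 ≤ Z := integral_nonneg fun x => (exp_pos _).le
  have hratio : ∀ x ∈ A, ∀ x' ∈ A, exp (-c * V x) ≤ exp (c * D) * exp (-c * V x') := by
    intro x hx x' hx'
    rw [← exp_add]
    gcongr
    nlinarith [hosc x' hx' x hx]
  have hWle : ∀ x ∈ A, exp (-c * V x) ≤ exp (c * D) * Z := by
    intro x hx
    have := integral_mono_ae (integrable_const (exp (-c * V x))) (hWi.const_mul (exp (c * D)))
      (by filter_upwards [hA] with x' hx' using hratio x hx x' hx')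
    simpa [integral_const_mul, hZ] using this
  have hleW : ∀ x ∈ A, Z ≤ exp (c * D) * exp (-c * V x) := by
    intro x hx
    have := integral_mono_ae hWi (integrable_const (exp (c * D) * exp (-c * V x)))
      (by filter_upwards [hA] with x' hx' using hratio x' hx' x hx)
    simpa [hZ] using this
  have hone : 1 ≤ exp (c * D) := one_le_exp (by positivity)
  have hdev : ∀ x ∈ A, |exp (-c * V x) - Z| ≤ (exp (c * D) - 1) * Z := by
    intro x hx
    have h1 := hWle x hx
    have h2 := hleW x hx
    rw [abs_le]
    constructor <;> nlinarith [exp_pos (-c * V x)]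
  have hUi : Integrable U κ :=
    Integrable.of_bound hU.aestronglyMeasurable B (by filter_upwards [hA] with x hx using hUB x hx)
  calc ∫ x, exp (-c * (V x + U x)) ∂κ
      ≤ ∫ x, (((1 + c ^ 2 * (B * (K * T))) * exp (-c * V x) - c * Z * U x)
          + c * ((exp (c * D) - 1) * Z * (K * T))) ∂κ := by
        refine integral_mono_ae hWU (((hWi.const_mul _).sub (hUi.const_mul _)).add
          (integrable_const _)) ?_
        filter_upwards [hA] with x hx
        have h1 : exp (-c * U x) ≤ 1 - c * U x + c ^ 2 * (B * (K * T)) := by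
          have hle : |-c * U x| ≤ 1 := by
            rw [abs_mul, abs_neg, abs_of_pos hc]
            nlinarith [hUB x hx]
          have h2 := (abs_le.1 (abs_exp_sub_one_sub_id_le hle)).2
          have h3 : U x ^ 2 ≤ B * (K * T) := by
            rw [← sq_abs, sq]
            exact mul_le_mul (hUB x hx) (hUT x hx) (abs_nonneg _) hB
          nlinarith [sq_nonneg c]
        have h4 : -(exp (-c * V x) - Z) * U x ≤ (exp (c * D) - 1) * Z * (K * T) := by
          refine (le_abs_self _).trans ?_
          rw [abs_mul, abs_neg]
          exact mul_le_mul (hdev x hx) (hUT x hx) (abs_nonneg _)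
            (mul_nonneg (by linarith) hZ0)
        have h5 := mul_le_mul_of_nonneg_left h1 (exp_pos (-c * V x)).le
        have h6 : exp (-c * (V x + U x)) = exp (-c * V x) * exp (-c * U x) := congrFun hsum x
        have h7 := mul_le_mul_of_nonneg_left h4 hc.le
        rw [h6]
        nlinarith
    _ = (1 + c ^ 2 * (B * (K * T))) * Z - c * Z * T + c * ((exp (c * D) - 1) * Z * (K * T)) := by
        have hi := (hWi.const_mul (1 + c ^ 2 * (B * (K * T)))).sub (hUi.const_mul (c * Z))
        simp only [Pi.sub_def] at hi
        rw [integral_add hi (integrable_const _), integral_sub (hWi.const_mul _) (hUi.const_mul _),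
          integral_const_mul, integral_const_mul, hT, ← hZ]
        simp
    _ ≤ (1 - c / 2 * T) * Z := by
        nlinarith [mul_le_mul_of_nonneg_left hsmall (mul_nonneg (mul_nonneg hc.le hT0) hZ0)]

end Drift
set_option linter.unusedSectionVars false

section Cylinder

/-- The sequence starting with the history `y` and continuing as `x`. -/
def glue (n : ℕ) (y : Hn O n) (x : Hw O) : Hw O :=
  fun i => if h : i < n then y ⟨i, h⟩ else x i

theorem glue_mem_cyl (n : ℕ) (y : Hn O n) (x : Hw O) : glue O n y x ∈ cyl O n y := by
  ext i
  simp [proj, glue]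

theorem glue_of_mem_cyl {n : ℕ} {y : Hn O n} {x : Hw O} (hx : x ∈ cyl O n y) :
    glue O n y x = x := by
  obtain rfl : proj O n x = y := hx
  ext i
  simp [proj, glue]

theorem continuous_glue (n : ℕ) (y : Hn O n) : Continuous (glue O n y) := by
  refine continuous_pi fun i => ?_
  by_cases h : i < n
  · simpa [glue, h] using continuous_const
  · simpa [glue, h] using continuous_apply i

theorem measurable_glue (n : ℕ) (x : Hw O) : Measurable fun y => glue O n y x := by
  refine measurable_pi_lambda _ fun i => ?_
  by_cases h : i < n
  · simpa [glue, h] using measurable_pi_apply (⟨i, h⟩ : Fin n)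
  · simp [glue, h]

theorem measurable_proj (n : ℕ) : Measurable (proj O n) :=
  measurable_pi_lambda _ fun i => measurable_pi_apply (i : ℕ)

theorem measurable_trunc {m n : ℕ} (h : m ≤ n) : Measurable (trunc O h) :=
  measurable_pi_lambda _ fun i => measurable_pi_apply (i.castLE h)

theorem proj_eq_of_le {m n : ℕ} (h : m ≤ n) {x x' : Hw O} (hx : proj O n x = proj O n x') :
    proj O m x = proj O m x' :=
  congrArg (trunc O h) hx

/-- The oscillation of a continuous function on the cylinders around a point tends to `0`. -/
theorem eventually_cyl_dist_lt (f : C(Hw O, ℝ)) (x : Hw O) {ε : ℝ} (hε : 0 < ε) :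
    ∀ᶠ n in atTop, ∀ x' ∈ cyl O n (proj O n x), |f x' - f x| < ε := by
  have h (n : ℕ) : ∃ z ∈ cyl O n (proj O n x),
      |f z - f x| < ε → ∀ x' ∈ cyl O n (proj O n x), |f x' - f x| < ε := by
    by_contra! hcon
    obtain ⟨h1, x', hx', h2⟩ := hcon x rfl
    exact (hcon x' hx').1.not_ge h2
  choose z hz hzf using h
  have hlim : Tendsto z atTop (𝓝 x) := by
    refine tendsto_pi_nhds.2 fun i => tendsto_const_nhds.congr' ?_
    filter_upwards [eventually_gt_atTop i] with n hn
    exact (congrFun (hz n) ⟨i, hn⟩).symm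
  have := (f.continuous.tendsto x).comp hlim
  filter_upwards [Metric.tendsto_nhds.1 this ε hε] with n hn
  exact hzf n hn

theorem sSup_image_sub_sInf_image_le_iff {X : Type*} {f : X → ℝ} {A : Set X} (hA : A.Nonempty)
    (ha : BddAbove (f '' A)) (hb : BddBelow (f '' A)) (b : ℝ) :
    sSup (f '' A) - sInf (f '' A) ≤ b ↔ ∀ x ∈ A, ∀ x' ∈ A, f x - f x' ≤ b := by
  constructor
  · intro h x hx x' hx'
    linarith [le_csSup ha (mem_image_of_mem f hx), csInf_le hb (mem_image_of_mem f hx')]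
  · intro h
    have h1 : sSup (f '' A) ≤ b + sInf (f '' A) := by
      refine csSup_le (hA.image f) ?_
      rintro _ ⟨x, hx, rfl⟩
      have : f x - b ≤ sInf (f '' A) := by
        refine le_csInf (hA.image f) ?_
        rintro _ ⟨x', hx', rfl⟩
        linarith [h x hx x' hx']
      linarith
    linarith

theorem bdd_image_continuousMap (f : C(Hw O, ℝ)) (A : Set (Hw O)) :
    BddAbove (f '' A) ∧ BddBelow (f '' A) :=
  have h := isCompact_range f.continuous
  ⟨h.bddAbove.mono (image_subset_range _ _), h.bddBelow.mono (image_subset_range _ _)⟩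

end Cylinder

section PrudentGambler

variable (S : Strategy O) (F : ∀ n, Hn O n → ProbabilityMeasure (Hw O))

/-- The bet of the gambler `PG S` playing against `F`, given the observation history `y`. -/
def pgBet (n : ℕ) (y : Hn O n) : C(Hw O, ℝ) :=
  (PGfun O S n (y, fhist O F n y)).curry (F n y)

/-- The payoff of the bet `pgBet`. -/
def pgGain (n : ℕ) (y : Hn O n) : C(Hw O, ℝ) :=
  pgBet O S F n y - ContinuousMap.const _ (∫ x, pgBet O S F n y x ∂(F n y : Measure (Hw O)))

/-- The total payoff of the bets of `PG S` in the first `n` rounds, the bets being placed along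
`x`, as a function of the outcome. -/
def pgTotalAt (x : Hw O) (n : ℕ) : C(Hw O, ℝ) :=
  ∑ m ∈ Finset.range n, pgGain O S F m (proj O m x)

/-- The total payoff of the first `n` bets of `PG S` against `F` along `x`. -/
def pgTotal (n : ℕ) (x : Hw O) : ℝ := pgTotalAt O S F x n x

/-- The total payoff of the previous bets varies by at most `1` on the previous cylinder. -/
def PgPlays (n : ℕ) (y : Hn O n) : Prop :=
  ∀ x ∈ cyl O (n - 1) (trunc O (Nat.sub_le n 1) y),
    ∀ x' ∈ cyl O (n - 1) (trunc O (Nat.sub_le n 1) y), pgTotal O S F n x - pgTotal O S F n x' ≤ 1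

theorem pgGain_apply (n : ℕ) (y : Hn O n) (x : Hw O) :
    pgGain O S F n y x = pgBet O S F n y x - ∫ x', pgBet O S F n y x' ∂(F n y : Measure (Hw O)) :=
  rfl

theorem pgTotal_succ (n : ℕ) (x : Hw O) :
    pgTotal O S F (n + 1) x = pgTotal O S F n x + pgGain O S F n (proj O n x) x := by
  simp [pgTotal, pgTotalAt, Finset.sum_range_succ]

theorem SVf_PGpre (n : ℕ) : SVf O (PGpre O S) F n = pgTotal O S F n := by
  ext x
  simp only [pgTotal, pgTotalAt, ContinuousMap.coe_sum, Finset.sum_apply]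
  exact Fin.sum_univ_eq_sum_range (fun m => pgGain O S F m (proj O m x) x) n

theorem pgTotal_eq_pgTotalAt {n k : ℕ} (h : n ≤ k + 1) {x x' : Hw O}
    (hx : proj O k x = proj O k x') : pgTotal O S F n x = pgTotalAt O S F x' n x := by
  simp only [pgTotal, pgTotalAt, ContinuousMap.coe_sum, Finset.sum_apply]
  refine Finset.sum_congr rfl fun m hm => ?_
  rw [proj_eq_of_le O (by grind : m ≤ k) hx]

open scoped Classical in
theorem pgBet_eq [Nonempty (Hw O)] (n : ℕ) (y : Hn O n) :
    pgBet O S F n y = if PgPlays O S F n y then (S.S n y).curry (F n y) else 0 := by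
  obtain ⟨x₀⟩ := ‹Nonempty (Hw O)›
  set A := cyl O (n - 1) (trunc O (Nat.sub_le n 1) y) with hA
  have hne : (glue O (n - 1) (trunc O (Nat.sub_le n 1) y) x₀) ∈ A := glue_mem_cyl ..
  have heq : EqOn (fun x => ∑ m : Fin n, Vbet (fun p => PGfun O S m
      (trunc O m.isLt.le y, fun i : Fin m => fhist O F n y (i.castLE m.isLt.le)) p)
      (fhist O F n y m) x) (pgTotal O S F n) A := by
    intro x hx
    rw [← SVf_PGpre]
    refine Finset.sum_congr rfl fun m _ => ?_
    have : proj O m x = trunc O m.isLt.le y :=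
      congrArg (trunc O (Nat.le_sub_one_of_lt m.isLt)) hx
    rw [this]
    rfl
  have hcont : EqOn (pgTotal O S F n) (pgTotalAt O S F
      (glue O (n - 1) (trunc O (Nat.sub_le n 1) y) x₀) n) A := fun x hx =>
    pgTotal_eq_pgTotalAt O S F (by omega : n ≤ (n - 1) + 1) (hx.trans hne.symm)
  have hbdd := bdd_image_continuousMap O (pgTotalAt O S F
      (glue O (n - 1) (trunc O (Nat.sub_le n 1) y) x₀) n) A
  rw [← hcont.image_eq] at hbdd
  have hiff := sSup_image_sub_sInf_image_le_iff ⟨_, hne⟩ hbdd.1 hbdd.2 1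
  rw [← heq.image_eq] at hiff
  rw [pgBet, PGfun]
  by_cases h : PgPlays O S F n y
  · rw [if_pos h]
    exact congrArg (fun β => ContinuousMap.curry β (F n y)) (if_pos (hiff.2 h))
  · rw [if_neg h]
    exact congrArg (fun β => ContinuousMap.curry β (F n y)) (if_neg fun h' => h (hiff.1 h'))

/-- The total payoff varies by a bounded amount on the cylinders. -/
theorem pgTotal_sub_le [Nonempty (Hw O)] {C : ℝ} (hC : ∀ n y p, |S.S n y p| ≤ C) (n : ℕ)
    {x x' : Hw O} (h : proj O (n - 1) x = proj O (n - 1) x') :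
    pgTotal O S F n x - pgTotal O S F n x' ≤ 1 + 2 * C := by
  have hC0 : 0 ≤ C :=
    (abs_nonneg _).trans (hC 0 (proj O 0 x) (F 0 (proj O 0 x), x))
  induction n with
  | zero => simp [pgTotal, pgTotalAt]; linarith
  | succ n ih =>
    replace h : proj O n x = proj O n x' := h
    have h' := proj_eq_of_le O (Nat.sub_le n 1) h
    rw [pgTotal_succ, pgTotal_succ, h, pgGain_apply, pgGain_apply, pgBet_eq]
    split_ifs with hp
    · have h1 := hp x h' x' rfl
      have h2 := abs_le.1 (hC n (proj O n x') (F n (proj O n x'), x))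
      have h3 := abs_le.1 (hC n (proj O n x') (F n (proj O n x'), x'))
      simp only [ContinuousMap.curry_apply]
      linarith
    · simpa using ih h'

theorem abs_pgGain_le [Nonempty (Hw O)] {C : ℝ} (hC : ∀ n y p, |S.S n y p| ≤ C) (n : ℕ)
    (y : Hn O n) (x : Hw O) : |pgGain O S F n y x| ≤ 2 * C := by
  have hC0 : 0 ≤ C := (abs_nonneg _).trans (hC n y (F n y, x))
  have hb (x : Hw O) : |pgBet O S F n y x| ≤ C := by
    rw [pgBet_eq]
    split_ifs
    · exact hC n y _
    · simpa using hC0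
  have hi : |∫ x', pgBet O S F n y x' ∂(F n y : Measure (Hw O))| ≤ C := by
    simpa using norm_integral_le_of_norm_le_const (μ := (F n y : Measure (Hw O)))
      (f := pgBet O S F n y) (C := C) (ae_of_all _ hb)
  rw [pgGain_apply]
  exact (abs_sub _ _).trans (by linarith [hb x])

section Measurability

theorem measurable_pgGain (hF : ∀ n, Measurable[univMS (Hn O n)] (F n)) {n : ℕ}
    (h : Measurable[univMS (Hn O n)] (pgBet O S F n)) :
    Measurable[univMS (Hn O n)] (pgGain O S F n) := by
  let := univMS (Hn O n)
  have hi := measurable_integral_continuousMap h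
    (measurable_integral_continuousMap_of_measurable (hF n))
  exact h.sub (ContinuousMap.continuous_const'.measurable.comp hi)

theorem measurable_pgTotal (hF : ∀ n, Measurable[univMS (Hn O n)] (F n)) {n : ℕ}
    (h : ∀ m < n, Measurable[univMS (Hn O m)] (pgBet O S F m)) :
    Measurable[univMS (Hw O)] (pgTotal O S F n) := by
  have hm (m : ℕ) (hm : m ∈ Finset.range n) :
      Measurable[univMS (Hw O)] fun x : Hw O => pgGain O S F m (proj O m x) x := by
    have h1 := (measurable_pgGain O S F hF (h m (Finset.mem_range.1 hm))).comp
      (measurable_proj O m).univMS_univMS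
    have h2 : Measurable[univMS (Hw O)] (id : Hw O → Hw O) := measurable_id.univMS_left
    have h3 : Measurable fun p : C(Hw O, ℝ) × Hw O => p.1 p.2 := continuous_eval.measurable
    let := univMS (Hw O)
    exact h3.comp (h1.prodMk h2)
  have := @Finset.measurable_fun_sum ℝ ℕ (Hw O) _ _ _ (univMS (Hw O)) _ (Finset.range n) hm
  convert this using 2 with x
  simp [pgTotal, pgTotalAt]

theorem measurableSet_pgPlays [Nonempty (Hw O)] {n : ℕ}
    (h : Measurable[univMS (Hw O)] (pgTotal O S F n)) :
    MeasurableSet[univMS (Hn O n)] {y | PgPlays O S F n y} := by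
  set g : Hn O n → Hw O → Hw O := fun y => glue O (n - 1) (trunc O (Nat.sub_le n 1) y) with hg
  have hiff (y : Hn O n) : PgPlays O S F n y ↔
      ∀ i j : ℕ, pgTotal O S F n (g y (TopologicalSpace.denseSeq (Hw O) i)) -
        pgTotal O S F n (g y (TopologicalSpace.denseSeq (Hw O) j)) ≤ 1 := by
    constructor
    · exact fun hp i j => hp _ (glue_mem_cyl ..) _ (glue_mem_cyl ..)
    · intro hd x hx x' hx'
      have hc : Continuous fun z => pgTotal O S F n (g y z) := by
        have : (fun z => pgTotal O S F n (g y z)) = fun z => pgTotalAt O S F x n (g y z) := by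
          ext z
          exact pgTotal_eq_pgTotalAt O S F (by omega : n ≤ (n - 1) + 1)
            ((glue_mem_cyl O _ _ z).trans hx.symm)
        rw [this]
        exact (pgTotalAt O S F x n).continuous.comp (continuous_glue ..)
      have := isClosed_property2 (TopologicalSpace.denseRange_denseSeq (Hw O))
        (p := fun z z' => pgTotal O S F n (g y z) - pgTotal O S F n (g y z') ≤ 1)
        (isClosed_le ((hc.comp continuous_fst).sub (hc.comp continuous_snd)) continuous_const) hd x x'
      rwa [show g y x = x from glue_of_mem_cyl O hx,
        show g y x' = x' from glue_of_mem_cyl O hx'] at this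
  simp_rw [hiff, Set.ofPred_forall]
  have hm (z : Hw O) : Measurable[univMS (Hn O n)] fun y => pgTotal O S F n (g y z) :=
    h.comp ((measurable_glue O (n - 1) z).comp (measurable_trunc O _)).univMS_univMS
  let := univMS (Hn O n)
  exact MeasurableSet.iInter fun i => MeasurableSet.iInter fun j =>
    measurableSet_le ((hm _).sub (hm _)) measurable_const

theorem measurable_pgBet [Nonempty (Hw O)] (hF : ∀ n, Measurable[univMS (Hn O n)] (F n)) (n : ℕ) :
    Measurable[univMS (Hn O n)] (pgBet O S F n) := by
  classical
  induction n using Nat.strong_induction_on with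
  | _ n ih =>
    have h1 := measurableSet_pgPlays O S F (measurable_pgTotal O S F hF ih)
    have h2 := S.measurable n
    have h3 := hF n
    simp_rw [funext (pgBet_eq O S F n)]
    let := univMS (Hn O n)
    exact Measurable.ite h1 (measurable_curry_apply h2 h3) measurable_const

end Measurability

end PrudentGambler
section Sequences

open Real

theorem exists_le_of_summable_mul_exp {V U T : ℕ → ℝ} {c K : ℝ} (hc : 0 < c) (hK : 0 ≤ K)
    (hV : ∀ n, V (n + 1) = V n + U n) (hUT : ∀ n, |U n| ≤ K * T n) (hU : ∀ n, c * |U n| ≤ 1)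
    (hT : ∀ n, 0 ≤ T n) (hs : Summable fun n => T n * exp (-c * V n)) : ∃ M, ∀ n, M ≤ V n := by
  set s := ∑' n, T n * exp (-c * V n) with hsdef
  set R := exp (-c * V 0) + 2 * c * K * s with hR
  have hstep (n : ℕ) : exp (-c * V (n + 1)) ≤
      exp (-c * V n) + 2 * c * K * (T n * exp (-c * V n)) := by
    have h1 : exp (-c * V (n + 1)) = exp (-c * V n) * exp (-c * U n) := by
      rw [hV, ← exp_add]; ring_nf
    have habs : |-c * U n| = c * |U n| := by rw [abs_mul, abs_neg, abs_of_pos hc]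
    have h2 := (abs_le.1 (abs_exp_sub_one_le (habs.le.trans (hU n)))).2
    rw [habs] at h2
    have h3 : exp (-c * U n) ≤ 1 + 2 * c * K * T n := by nlinarith [hUT n]
    rw [h1]
    nlinarith [mul_le_mul_of_nonneg_left h3 (exp_pos (-c * V n)).le]
  have hsum (n : ℕ) : exp (-c * V n) ≤
      exp (-c * V 0) + 2 * c * K * ∑ i ∈ Finset.range n, T i * exp (-c * V i) := by
    induction n with
    | zero => simp
    | succ n ih => rw [Finset.sum_range_succ]; linarith [hstep n]
  have hbound (n : ℕ) : exp (-c * V n) ≤ R := by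
    refine (hsum n).trans ?_
    have := hs.sum_le_tsum (Finset.range n) fun i _ => mul_nonneg (hT i) (exp_pos _).le
    rw [hR]
    gcongr
  refine ⟨-log R / c, fun n => ?_⟩
  have h1 := log_le_log (exp_pos _) (hbound n)
  rw [log_exp] at h1
  rw [div_le_iff₀ hc]
  linarith

theorem summable_of_summable_mul_exp {V T : ℕ → ℝ} {c M : ℝ} (hc : 0 < c) (hV : ∀ n, V n ≤ M)
    (hT : ∀ n, 0 ≤ T n) (hs : Summable fun n => T n * exp (-c * V n)) : Summable T := by
  refine (hs.mul_right (exp (c * M))).of_nonneg_of_le hT fun n => ?_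
  rw [mul_assoc, ← exp_add]
  refine le_mul_of_one_le_right (hT n) (one_le_exp ?_)
  nlinarith [hV n]

theorem bddAbove_range_sum_of_eventually_le {a T : ℕ → ℝ} (ha : ∀ᶠ n in atTop, a n ≤ T n)
    (ha0 : ∀ n, 0 ≤ a n) (hT : Summable T) :
    BddAbove (Set.range fun N : ℕ => ∑ n ∈ Finset.range N, a n) := by
  have hs : Summable a := hT.of_norm_bounded_eventually_nat (by
    filter_upwards [ha] with n hn
    rwa [norm_of_nonneg (ha0 n)])
  refine ⟨∑' n, a n, ?_⟩
  rintro _ ⟨N, rfl⟩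
  exact hs.sum_le_tsum _ fun i _ => ha0 i

theorem exists_pos_small (K B D : ℝ) :
    ∃ c : ℝ, 0 < c ∧ c * B ≤ 1 ∧ (exp (c * D) - 1) * K + c * B * K ≤ 1 / 2 := by
  have h1 : Tendsto (fun c : ℝ => c * B) (𝓝[>] 0) (𝓝 (0 * B)) :=
    ((continuous_id.mul continuous_const).tendsto 0).mono_left nhdsWithin_le_nhds
  have h2 : Tendsto (fun c : ℝ => (exp (c * D) - 1) * K + c * B * K) (𝓝[>] 0)
      (𝓝 ((exp (0 * D) - 1) * K + 0 * B * K)) :=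
    (Continuous.tendsto (by fun_prop) 0).mono_left nhdsWithin_le_nhds
  simp only [zero_mul, exp_zero, sub_self, add_zero] at h1 h2
  obtain ⟨c, h, h', h''⟩ := ((eventually_mem_nhdsWithin (a := (0 : ℝ)) (s := Set.Ioi 0)).and ((h1.eventually_le_const one_pos).and
    (h2.eventually_le_const (by norm_num : (0 : ℝ) < 1 / 2)))).exists
  exact ⟨c, h, h', h''⟩

theorem tsum_le_of_add_le {a t : ℕ → ℝ≥0∞} (h : ∀ n, a (n + 1) + t n ≤ a n) :
    ∑' n, t n ≤ a 0 := by
  have hs (N : ℕ) : a N + ∑ n ∈ Finset.range N, t n ≤ a 0 := by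
    induction N with
    | zero => simp
    | succ N ih =>
      rw [Finset.sum_range_succ]
      calc a (N + 1) + (∑ n ∈ Finset.range N, t n + t N)
          = (a (N + 1) + t N) + ∑ n ∈ Finset.range N, t n := by ring
        _ ≤ a N + ∑ n ∈ Finset.range N, t n := by gcongr; exact h N
        _ ≤ a 0 := ih
  exact ENNReal.tsum_le_of_sum_range_le fun N => le_add_self.trans (hs N)

end Sequences

theorem IsRCP.bind_eq {X Y : Type*} [MeasurableSpace X] [MeasurableSpace Y] {μ : Measure X}
    {π : X → Y} {κ : Y → ProbabilityMeasure X} (h : IsRCP μ π κ) :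
    (μ.map π).bind (fun y => (κ y : Measure X)) = μ := by
  ext s hs
  rw [Measure.bind_apply hs h.1.aemeasurable]
  simpa using (h.2.1 s hs univ MeasurableSet.univ).symm

section Drift

variable (S : Strategy O) (F : ∀ n, Hn O n → ProbabilityMeasure (Hw O))
  (κ : ∀ n, Hn O n → ProbabilityMeasure (Hw O))

/-- The difference between the expected values of the bet of `PG S` under `κ` and under `F`. -/
def pgDrift (n : ℕ) (y : Hn O n) : ℝ :=
  ∫ x, pgBet O S F n y x ∂(κ n y : Measure (Hw O)) -
    ∫ x, pgBet O S F n y x ∂(F n y : Measure (Hw O))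

/-- The history `y` is one where the prudence inequality with constant `α` holds for `κ`, and `κ`
is concentrated on the cylinder over `y`. -/
def IsPrudentAt (α : ℝ) (n : ℕ) (y : Hn O n) : Prop :=
  (κ n y : Measure (Hw O)) (cyl O n y) = 1 ∧ ∀ μ : ProbabilityMeasure (Hw O),
    α * (sSup ((fun x => S.S n y (μ, x)) '' cyl O n y) -
         sInf ((fun x => S.S n y (μ, x)) '' cyl O n y)) ≤
      (∫ x, S.S n y (μ, x) ∂(κ n y : Measure (Hw O))) -
        ∫ x, S.S n y (μ, x) ∂(μ : Measure (Hw O))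

variable {O S κ}

theorem measurableSet_cyl (n : ℕ) (y : Hn O n) : MeasurableSet (cyl O n y) :=
  measurable_proj O n (measurableSet_singleton y)

theorem IsPrudentAt.ae_mem {α : ℝ} {n : ℕ} {y : Hn O n} (h : IsPrudentAt O S κ α n y) :
    ∀ᵐ x ∂(κ n y : Measure (Hw O)), x ∈ cyl O n y :=
  (mem_ae_iff_prob_eq_one (measurableSet_cyl n y)).2 h.1

theorem IsPrudentAt.mul_sub_le {α : ℝ} (hα : 0 < α) {n : ℕ} {y : Hn O n}
    (h : IsPrudentAt O S κ α n y) {x x' : Hw O} (hx : x ∈ cyl O n y) (hx' : x' ∈ cyl O n y)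
    (μ : ProbabilityMeasure (Hw O)) :
    α * (S.S n y (μ, x) - S.S n y (μ, x')) ≤ (∫ x, S.S n y (μ, x) ∂(κ n y : Measure (Hw O))) -
        ∫ x, S.S n y (μ, x) ∂(μ : Measure (Hw O)) := by
  have hb := bdd_image_continuousMap O ((S.S n y).curry μ) (cyl O n y)
  have := (sSup_image_sub_sInf_image_le_iff ⟨x, hx⟩ hb.1 hb.2 _).1 le_rfl x hx x' hx'
  exact (mul_le_mul_of_nonneg_left this hα.le).trans (h.2 μ)

theorem IsPrudentAt.mul_pgBet_sub_le [Nonempty (Hw O)] {α : ℝ} (hα : 0 < α) {n : ℕ} {y : Hn O n}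
    (h : IsPrudentAt O S κ α n y) {x x' : Hw O} (hx : x ∈ cyl O n y) (hx' : x' ∈ cyl O n y) :
    α * (pgBet O S F n y x - pgBet O S F n y x') ≤ pgDrift O S F κ n y := by
  rw [pgDrift, pgBet_eq]
  split_ifs
  · exact h.mul_sub_le hα hx hx' _
  · simp

theorem IsPrudentAt.pgDrift_nonneg [Nonempty (Hw O)] {α : ℝ} (hα : 0 < α) {n : ℕ} {y : Hn O n}
    (h : IsPrudentAt O S κ α n y) : 0 ≤ pgDrift O S F κ n y := by
  obtain ⟨x⟩ := ‹Nonempty (Hw O)›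
  have := h.mul_pgBet_sub_le F hα (glue_mem_cyl O n y x) (glue_mem_cyl O n y x)
  simpa using this

theorem integral_pgGain (n : ℕ) (y : Hn O n) :
    ∫ x, pgGain O S F n y x ∂(κ n y : Measure (Hw O)) = pgDrift O S F κ n y := by
  simp only [pgGain_apply]
  rw [integral_sub (integrable_continuousMap _ _) (integrable_const _)]
  simp [pgDrift]

theorem IsPrudentAt.abs_pgGain_le_mul_pgDrift [Nonempty (Hw O)] {α : ℝ} (hα : 0 < α) {n : ℕ} {y : Hn O n}
    (h : IsPrudentAt O S κ α n y) {x : Hw O} (hx : x ∈ cyl O n y) :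
    |pgGain O S F n y x| ≤ (α⁻¹ + 1) * pgDrift O S F κ n y := by
  set T := pgDrift O S F κ n y with hT
  have hosc : ∀ x ∈ cyl O n y, ∀ x' ∈ cyl O n y,
      pgBet O S F n y x - pgBet O S F n y x' ≤ α⁻¹ * T := fun x hx x' hx' => by
    rw [le_inv_mul_iff₀ hα]
    exact h.mul_pgBet_sub_le F hα hx hx'
  have hi := integrable_continuousMap (κ n y : Measure (Hw O)) (pgBet O S F n y)
  have h1 : pgBet O S F n y x ≤ (∫ x, pgBet O S F n y x ∂(κ n y : Measure (Hw O))) + α⁻¹ * T := by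
    have := integral_mono_ae (integrable_const (pgBet O S F n y x - α⁻¹ * T)) hi (by
      filter_upwards [h.ae_mem] with x' hx'
      linarith [hosc x hx x' hx'])
    simp only [integral_const, probReal_univ, one_smul] at this
    linarith
  have h2 : (∫ x, pgBet O S F n y x ∂(κ n y : Measure (Hw O))) ≤ pgBet O S F n y x + α⁻¹ * T := by
    have := integral_mono_ae hi (integrable_const (pgBet O S F n y x + α⁻¹ * T)) (by
      filter_upwards [h.ae_mem] with x' hx'
      linarith [hosc x' hx' x hx])
    simpa only [integral_const, probReal_univ, one_smul] using this
  have h3 := h.pgDrift_nonneg F hα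
  rw [pgGain_apply, abs_le]
  rw [pgDrift] at hT
  constructor <;> linarith

theorem measurable_pgDrift [Nonempty (Hw O)] (hF : ∀ n, Measurable[univMS (Hn O n)] (F n))
    (n : ℕ) (hκ : Measurable fun y => (κ n y : Measure (Hw O))) :
    Measurable[univMS (Hn O n)] (pgDrift O S F κ n) := by
  have hb := measurable_pgBet O S F hF n
  have hκ' := hκ.univMS_left
  have hF' := hF n
  let := univMS (Hn O n)
  exact (measurable_integral_continuousMap hb
    (measurable_integral_continuousMap_of_measurable_coe hκ')).sub
    (measurable_integral_continuousMap hb (measurable_integral_continuousMap_of_measurable hF'))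

theorem IsPrudentAt.lintegral_exp_le [Nonempty (Hw O)] {α C c : ℝ} (hα : 0 < α)
    (hC : ∀ n y p, |S.S n y p| ≤ C) (hc : 0 < c) (hcC : c * (2 * C) ≤ 1)
    (hsmall : (Real.exp (c * (1 + 2 * C)) - 1) * (α⁻¹ + 1) + c * (2 * C) * (α⁻¹ + 1) ≤ 1 / 2)
    {n : ℕ} {y : Hn O n} (h : IsPrudentAt O S κ α n y) :
    ∫⁻ x, (ENNReal.ofReal (Real.exp (-c * pgTotal O S F (n + 1) x)) +
      ENNReal.ofReal (c / 2 * (pgDrift O S F κ n (proj O n x) *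
        Real.exp (-c * pgTotal O S F n x)))) ∂(κ n y : Measure (Hw O)) ≤
    ∫⁻ x, ENNReal.ofReal (Real.exp (-c * pgTotal O S F n x)) ∂(κ n y : Measure (Hw O)) := by
  obtain ⟨x₁⟩ := ‹Nonempty (Hw O)›
  set x₀ := glue O n y x₁
  have hx₀ : x₀ ∈ cyl O n y := glue_mem_cyl ..
  have hV : ∀ x ∈ cyl O n y, pgTotal O S F n x = pgTotalAt O S F x₀ n x := fun x hx =>
    pgTotal_eq_pgTotalAt O S F n.le_succ (hx.trans hx₀.symm)
  have hT0 := h.pgDrift_nonneg F hα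
  obtain ⟨hi, hi', hle⟩ := integral_exp_neg_add_le (κ n y : Measure (Hw O))
    (V := pgTotalAt O S F x₀ n) (U := pgGain O S F n y) (K := α⁻¹ + 1) (B := 2 * C)
    (D := 1 + 2 * C) (A := cyl O n y) (c := c) (T := pgDrift O S F κ n y)
    (pgTotalAt O S F x₀ n).continuous.measurable (pgGain O S F n y).continuous.measurable
    h.ae_mem (fun x hx x' hx' => by
      rw [← hV x hx, ← hV x' hx']
      exact pgTotal_sub_le O S F hC n (proj_eq_of_le O (n.sub_le 1) (hx.trans hx'.symm)))
    (fun x hx => h.abs_pgGain_le_mul_pgDrift F hα hx) (fun x _ => abs_pgGain_le O S F hC n y x)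
    (integral_pgGain F n y) hc hcC hT0 hsmall
  set V := pgTotalAt O S F x₀ n
  set U := pgGain O S F n y
  set T := pgDrift O S F κ n y
  calc _ = ∫⁻ x, ENNReal.ofReal (Real.exp (-c * (V x + U x)) + c / 2 * T * Real.exp (-c * V x))
        ∂(κ n y : Measure (Hw O)) := by
        refine lintegral_congr_ae ?_
        filter_upwards [h.ae_mem] with x hx
        rw [pgTotal_succ, hV x hx, show proj O n x = y from hx, ← mul_assoc,
          ← ENNReal.ofReal_add (Real.exp_pos _).le (by positivity)]
    _ = ENNReal.ofReal (∫ x, (Real.exp (-c * (V x + U x)) + c / 2 * T * Real.exp (-c * V x))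
        ∂(κ n y : Measure (Hw O))) :=
        (ofReal_integral_eq_lintegral_ofReal (hi'.add (hi.const_mul _))
          (ae_of_all _ fun x => add_nonneg (Real.exp_pos _).le
            (mul_nonneg (mul_nonneg (half_pos hc).le hT0) (Real.exp_pos _).le))).symm
    _ ≤ ENNReal.ofReal (∫ x, Real.exp (-c * V x) ∂(κ n y : Measure (Hw O))) := by
        refine ENNReal.ofReal_le_ofReal ?_
        rw [integral_add hi' (hi.const_mul _), integral_const_mul]
        linarith
    _ = ∫⁻ x, ENNReal.ofReal (Real.exp (-c * V x)) ∂(κ n y : Measure (Hw O)) :=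
        ofReal_integral_eq_lintegral_ofReal hi (ae_of_all _ fun x => (Real.exp_pos _).le)
    _ = _ := by
        refine lintegral_congr_ae ?_
        filter_upwards [h.ae_mem] with x hx
        rw [hV x hx]

/-- Almost surely, the drift of `PG S` weighted by an exponential of its losses is summable. -/
theorem ae_summable_pgDrift_mul_exp {μ : Measure (Hw O)} [IsProbabilityMeasure μ]
    [Nonempty (Hw O)] (hF : ∀ n, Measurable[univMS (Hn O n)] (F n))
    (hκ : ∀ n, IsRCP μ (proj O n) (κ n)) {α C c : ℝ} (hα : 0 < α)
    (hC : ∀ n y p, |S.S n y p| ≤ C) (hc : 0 < c) (hcC : c * (2 * C) ≤ 1)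
    (hsmall : (Real.exp (c * (1 + 2 * C)) - 1) * (α⁻¹ + 1) + c * (2 * C) * (α⁻¹ + 1) ≤ 1 / 2)
    (hp : ∀ n, ∀ᵐ y ∂(μ.map (proj O n)), IsPrudentAt O S κ α n y) :
    ∀ᵐ x ∂μ, Summable fun n =>
      pgDrift O S F κ n (proj O n x) * Real.exp (-c * pgTotal O S F n x) := by
  have hVm (n : ℕ) : AEMeasurable (pgTotal O S F n) μ :=
    aemeasurable_of_univMS (measurable_pgTotal O S F hF fun m _ => measurable_pgBet O S F hF m) μ
  have hTm (n : ℕ) : AEMeasurable (fun x => pgDrift O S F κ n (proj O n x)) μ :=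
    aemeasurable_of_univMS ((measurable_pgDrift F hF n (hκ n).1).comp
      (measurable_proj O n).univMS_univMS) μ
  set w : ℕ → Hw O → ℝ≥0∞ := fun n x => ENNReal.ofReal (Real.exp (-c * pgTotal O S F n x))
  set t : ℕ → Hw O → ℝ≥0∞ := fun n x => ENNReal.ofReal (c / 2 *
    (pgDrift O S F κ n (proj O n x) * Real.exp (-c * pgTotal O S F n x)))
  have hwm (n : ℕ) : AEMeasurable (w n) μ := by
    have := hVm n; fun_prop
  have htm (n : ℕ) : AEMeasurable (t n) μ := by
    have := hVm n; have := hTm n; fun_prop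
  have hdis (n : ℕ) {f : Hw O → ℝ≥0∞} (hf : AEMeasurable f μ) :
      ∫⁻ x, f x ∂μ = ∫⁻ y, ∫⁻ x, f x ∂(κ n y : Measure (Hw O)) ∂(μ.map (proj O n)) := by
    conv_lhs => rw [← (hκ n).bind_eq]
    exact Measure.lintegral_bind (hκ n).1.aemeasurable (by rwa [(hκ n).bind_eq])
  have hstep (n : ℕ) : ∫⁻ x, w (n + 1) x ∂μ + ∫⁻ x, t n x ∂μ ≤ ∫⁻ x, w n x ∂μ := by
    rw [← lintegral_add_left' (hwm (n + 1)), hdis n (f := fun x => w (n + 1) x + t n x) ((hwm (n + 1)).add (htm n)),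
      hdis n (hwm n)]
    refine lintegral_mono_ae ?_
    filter_upwards [hp n] with y hy
    exact hy.lintegral_exp_le F hα hC hc hcC hsmall
  have hfin : ∫⁻ x, ∑' n, t n x ∂μ ≠ ∞ := by
    rw [lintegral_tsum htm]
    refine ne_top_of_le_ne_top ?_ (tsum_le_of_add_le hstep)
    simp [w, pgTotal, pgTotalAt]
  have hp' : ∀ᵐ x ∂μ, ∀ n, IsPrudentAt O S κ α n (proj O n x) :=
    ae_all_iff.2 fun n => ae_of_ae_map (measurable_proj O n).aemeasurable (hp n)
  filter_upwards [ae_lt_top' (AEMeasurable.tsum htm) hfin, hp'] with x hx hpx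
  have := ENNReal.summable_toReal hx.ne
  refine (summable_mul_left_iff (half_pos hc).ne').1 (this.congr fun n => ?_)
  exact ENNReal.toReal_ofReal (mul_nonneg (half_pos hc).le
    (mul_nonneg ((hpx n).pgDrift_nonneg F hα) (Real.exp_pos _).le))

/-- Once the drift of `PG S` is summable along `x`, the gambler eventually plays every round. -/
theorem eventually_pgPlays [Nonempty (Hw O)] {α : ℝ} (hα : 0 < α) {x : Hw O}
    (hp : ∀ n, IsPrudentAt O S κ α n (proj O n x))
    (hs : Summable fun n => pgDrift O S F κ n (proj O n x)) :
    ∀ᶠ n in atTop, PgPlays O S F n (proj O n x) := by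
  set T : ℕ → ℝ := fun n => pgDrift O S F κ n (proj O n x) with hT
  have hT0 (n : ℕ) : 0 ≤ T n := (hp n).pgDrift_nonneg F hα
  obtain ⟨N, hN⟩ : ∃ N, ∑' n, T (n + N) < α / 2 :=
    ((tendsto_sum_nat_add T).eventually_lt_const (half_pos hα)).exists
  have hcyl := eventually_cyl_dist_lt O (pgTotalAt O S F x N) x (by norm_num : (0 : ℝ) < 1 / 4)
  filter_upwards [(tendsto_sub_atTop_nat 1).eventually hcyl, eventually_gt_atTop N]
    with n hn hNn x₁ hx₁ x₂ hx₂
  change proj O (n - 1) x₁ = proj O (n - 1) x at hx₁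
  change proj O (n - 1) x₂ = proj O (n - 1) x at hx₂
  have hsplit (z : Hw O) : pgTotalAt O S F x n z = pgTotalAt O S F x N z +
      ∑ i ∈ Finset.range (n - N), pgGain O S F (i + N) (proj O (i + N) x) z := by
    obtain ⟨k, rfl⟩ := Nat.exists_eq_add_of_lt hNn
    rw [show N + k + 1 = N + (k + 1) by ring]
    have hcomm (i : ℕ) : pgGain O S F (i + N) (proj O (i + N) x) =
        pgGain O S F (N + i) (proj O (N + i) x) := by rw [add_comm]
    simp only [pgTotalAt, Finset.sum_range_add _ N (k + 1), ContinuousMap.add_apply, ContinuousMap.sum_apply,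
      Nat.add_sub_cancel_left, hcomm]
  have htail : ∑ i ∈ Finset.range (n - N), pgGain O S F (i + N) (proj O (i + N) x) x₁ -
      ∑ i ∈ Finset.range (n - N), pgGain O S F (i + N) (proj O (i + N) x) x₂ ≤ 1 / 2 := by
    rw [← Finset.sum_sub_distrib]
    calc _ ≤ ∑ i ∈ Finset.range (n - N), α⁻¹ * T (i + N) := by
          refine Finset.sum_le_sum fun i hi => ?_
          have hin : i + N ≤ n - 1 := by grind
          rw [pgGain_apply, pgGain_apply, sub_sub_sub_cancel_right, le_inv_mul_iff₀ hα]
          exact (hp (i + N)).mul_pgBet_sub_le F hα (proj_eq_of_le O hin hx₁)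
            (proj_eq_of_le O hin hx₂)
      _ ≤ α⁻¹ * ∑' i, T (i + N) := by
          rw [← Finset.mul_sum]
          gcongr
          exact ((summable_nat_add_iff N).2 hs).sum_le_tsum _ fun i _ => hT0 _
      _ ≤ 1 / 2 := by
          rw [inv_mul_le_iff₀ hα]
          linarith
  rw [pgTotal_eq_pgTotalAt O S F (by omega : n ≤ (n - 1) + 1) hx₁,
    pgTotal_eq_pgTotalAt O S F (by omega : n ≤ (n - 1) + 1) hx₂, hsplit, hsplit]
  have h1 := abs_lt.1 (hn x₁ hx₁)
  have h2 := abs_lt.1 (hn x₂ hx₂)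
  linarith

theorem bddBelow_SVfMin [Nonempty (Hw O)] {C M : ℝ} (hC : ∀ n y p, |S.S n y p| ≤ C) {x : Hw O}
    (hM : ∀ n, M ≤ pgTotal O S F n x) :
    BddBelow (Set.range fun n => SVfMin O (PGpre O S) F n (proj O (n - 1) x)) := by
  refine ⟨M - (1 + 2 * C), ?_⟩
  rintro _ ⟨n, rfl⟩
  refine le_csInf (Set.Nonempty.image _ ⟨x, rfl⟩) ?_
  rintro _ ⟨x', hx', rfl⟩
  rw [SVf_PGpre]
  linarith [hM n, pgTotal_sub_le O S F hC n (hx' : proj O (n - 1) x' = proj O (n - 1) x).symm]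

theorem exists_pgTotal_le [Nonempty (Hw O)] {C : ℝ} (hC : ∀ n y p, |S.S n y p| ≤ C) {x : Hw O}
    (h : BddAbove (Set.range fun n => SVfMax O (PGpre O S) F n (proj O (n - 1) x))) :
    ∃ M, ∀ n, pgTotal O S F n x ≤ M := by
  obtain ⟨M, hM⟩ := h
  refine ⟨M, fun n => le_trans ?_ (hM ⟨n, rfl⟩)⟩
  refine le_csSup ⟨pgTotal O S F n x + (1 + 2 * C), ?_⟩ ⟨x, rfl, by rw [SVf_PGpre]⟩
  rintro _ ⟨x', hx', rfl⟩
  rw [SVf_PGpre]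
  linarith [pgTotal_sub_le O S F hC n (hx' : proj O (n - 1) x' = proj O (n - 1) x)]

end Drift

/-- Theorem 4.1 of the paper: if `S` is a `μ*`-prudent gambling strategy
and `F` dominates `PG S`, then `μ*`-almost surely the series of gaps between the conditional
expectations of the bets under `μ*` and their expectations under the forecasts is finite
(the `κ n` are regular conditional probabilities of `μ*` given `pr_n`). -/
theorem statement12 (μstar : ProbabilityMeasure (Hw O)) (S : Strategy O)
    (hprud : IsPrudent O S μstar) (F : Forecaster O) (hdom : Dominates O F.F (PGpre O S))
    (κ : ∀ n : ℕ, Hn O n → ProbabilityMeasure (Hw O))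
    (hκ : ∀ n, IsRCP (μstar : Measure (Hw O)) (proj O n) (κ n)) :
    ∀ᵐ x ∂(μstar : Measure (Hw O)),
      BddAbove (Set.range fun N : ℕ => ∑ n ∈ Finset.range N,
        ((∫ x', S.S n (proj O n x) (F.F n (proj O n x), x')
            ∂(κ n (proj O n x) : Measure (Hw O))) -
          ∫ x', S.S n (proj O n x) (F.F n (proj O n x), x')
            ∂(F.F n (proj O n x) : Measure (Hw O)))) := by
  have : Nonempty (Hw O) := nonempty_of_isProbabilityMeasure (μstar : Measure (Hw O))
  obtain ⟨α, hα, hprud⟩ := hprud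
  obtain ⟨C, hC⟩ := S.bounded
  obtain ⟨c, hc, hcC, hsmall⟩ := exists_pos_small (α⁻¹ + 1) (2 * C) (1 + 2 * C)
  have hp (n : ℕ) : ∀ᵐ y ∂((μstar : Measure (Hw O)).map (proj O n)), IsPrudentAt O S κ α n y := by
    filter_upwards [(hκ n).2.2, hprud n (κ n) (hκ n)] with y h1 h2 using ⟨h1, h2⟩
  have hp' : ∀ᵐ x ∂(μstar : Measure (Hw O)), ∀ n, IsPrudentAt O S κ α n (proj O n x) :=
    ae_all_iff.2 fun n => ae_of_ae_map (measurable_proj O n).aemeasurable (hp n)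
  filter_upwards [hp', ae_summable_pgDrift_mul_exp F.F F.measurable hκ hα hC hc hcC hsmall hp]
    with x hpx hsx
  have hT0 (n : ℕ) := (hpx n).pgDrift_nonneg F.F hα
  obtain ⟨M, hM⟩ := exists_le_of_summable_mul_exp hc (by positivity)
    (fun n => pgTotal_succ O S F.F n x) (fun n => (hpx n).abs_pgGain_le_mul_pgDrift F.F hα rfl)
    (fun n => (mul_le_mul_of_nonneg_left (abs_pgGain_le O S F.F hC n _ x) hc.le).trans hcC) hT0 hsx
  obtain ⟨M', hM'⟩ := exists_pgTotal_le F.F hC (hdom x (bddBelow_SVfMin F.F hC hM))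
  have hs := summable_of_summable_mul_exp hc hM' hT0 hsx
  refine bddAbove_range_sum_of_eventually_le ?_ (fun n => ?_) hs
  · filter_upwards [eventually_pgPlays F.F hα hpx hs] with n hn
    rw [pgDrift, pgBet_eq, if_pos hn]
    rfl
  · simpa using (hpx n).mul_sub_le hα (rfl : x ∈ cyl O n (proj O n x)) rfl (F.F n (proj O n x))

end
end

section
/- Let X be a compact Polish space with metrization ρ, M ⊆ P(X) convex and nonempty, r₀ > 0, and μ₀ ∈ P(X) with r := D^ρ(μ₀, M) > r₀. Then there exists a Lipschitz function f : X → ℝ such that ‖f‖_ρ < r − r₀ and inf_{ν∈M} E_ν[f] − E_{μ₀}[f] > ½(r − r₀)·r. -/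
open MeasureTheory Filter Set Topology
open scoped NNReal ENNReal

noncomputable section

/-- A minimax principle for a compact convex set and a convex set of continuous functionals. -/
lemma exists_forall_le_apply_of_forall_exists_le {E : Type*} [NormedAddCommGroup E]
    [NormedSpace ℝ E] {B : Set E} (hne : B.Nonempty) (hB : Convex ℝ B) (hBc : IsCompact B)
    {Y : Set (StrongDual ℝ E)} (hY : Convex ℝ Y) {t : ℝ} (h : ∀ L ∈ Y, ∃ f ∈ B, t ≤ L f) :
    ∃ f ∈ B, ∀ L ∈ Y, t ≤ L f := by
  by_contra! hcon
  obtain ⟨s, hsY, hs, hcov⟩ := hBc.elim_finite_subcover_image (b := Y)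
    (c := fun L : StrongDual ℝ E => {f | L f < t})
    (fun L _ => isOpen_lt L.continuous continuous_const)
    (fun f hf => by simpa using hcon f hf)
  obtain ⟨L, hL, hlt⟩ := Sion.exists_lt_iInf_of_lt_iInf_of_finite
    (f := fun (f : E) (L : StrongDual ℝ E) => -L f) hne hBc
    (fun L _ => L.continuous.neg.lowerSemicontinuous.lowerSemicontinuousOn _)
    (fun L _ => ((-L).toLinearMap.convexOn hB).quasiconvexOn) hY
    (fun f _ => (ContinuousLinearMap.apply ℝ ℝ f).continuous.neg.upperSemicontinuous
      |>.upperSemicontinuousOn _)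
    (fun f _ => ((-ContinuousLinearMap.apply ℝ ℝ f).toLinearMap.concaveOn hY).quasiconcaveOn)
    hB hs hsY (t := -t) (fun f hf => by simpa using hcov hf)
  obtain ⟨f, hf, hle⟩ := h L hL
  have := hlt f hf
  linarith

section KantorovichRubinstein

open BoundedContinuousFunction

variable {X : Type*} [MetricSpace X]

/-- Integration against a probability measure as a continuous linear functional. -/
def integralBCF [MeasurableSpace X] [BorelSpace X] (μ : ProbabilityMeasure X) :
    StrongDual ℝ (X →ᵇ ℝ) :=
  LinearMap.mkContinuous
    { toFun := fun f => ∫ x, f x ∂(μ : Measure X)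
      map_add' := fun f g => integral_add (f.integrable _) (g.integrable _)
      map_smul' := fun c f => integral_const_mul c f } 1
    (fun f => by simpa using f.norm_integral_le_norm (μ : Measure X))

@[simp]
lemma integralBCF_apply [MeasurableSpace X] [BorelSpace X] (μ : ProbabilityMeasure X)
    (f : X →ᵇ ℝ) : integralBCF μ f = ∫ x, f x ∂(μ : Measure X) := rfl

lemma ConvexPM.convex_image_integralBCF [MeasurableSpace X] [BorelSpace X]
    {M : Set (ProbabilityMeasure X)} (hM : ConvexPM M) : Convex ℝ (integralBCF '' M) := by
  rintro _ ⟨μ, hμ, rfl⟩ _ ⟨ν, hν, rfl⟩ a b ha hb hab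
  lift a to ℝ≥0 using ha
  lift b to ℝ≥0 using hb
  have hab' : a + b = 1 := by exact_mod_cast hab
  have hb' : b = 1 - a := by rw [← hab', add_tsub_cancel_left]
  have ha' : a ≤ 1 := hab' ▸ le_self_add
  let ξ : ProbabilityMeasure X := ⟨a • (μ : Measure X) + b • (ν : Measure X), ⟨by
    rw [Measure.add_apply, Measure.smul_apply, Measure.smul_apply, measure_univ, measure_univ,
      ENNReal.smul_def, ENNReal.smul_def, smul_eq_mul, smul_eq_mul, mul_one, mul_one,
      ← ENNReal.coe_add, hab', ENNReal.coe_one]⟩⟩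
  have hξ : (ξ : Measure X) = a • (μ : Measure X) + b • (ν : Measure X) := rfl
  refine ⟨ξ, hM μ hμ ν hν a ha' ξ (hb' ▸ hξ), ?_⟩
  ext f
  rw [integralBCF_apply, hξ, integral_add_measure
    ((f.integrable _).smul_measure_nnreal) ((f.integrable _).smul_measure_nnreal),
    integral_smul_nnreal_measure, integral_smul_nnreal_measure]
  simp [NNReal.smul_def]

/-- The bound `‖f‖_ρ ≤ C` on bounded continuous functions, written pointwise. -/
def lipNormBall (X : Type*) [MetricSpace X] (C : ℝ) : Set (X →ᵇ ℝ) :=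
  {f | ∀ x y z, |f x| + |f y - f z| / dist y z ≤ C}

lemma lipNorm_le_of_forall [Nonempty X] {f : X → ℝ} {C : ℝ}
    (h : ∀ x y z, |f x| + |f y - f z| / dist y z ≤ C) : lipNorm dist f ≤ C := by
  have h0 : ∀ x, |f x| ≤ C := fun x => by simpa using h x x x
  have hsup : ∀ x, |f x| ≤ C - sSup {c | ∃ y z, y ≠ z ∧ c = |f y - f z| / dist y z} := by
    intro x
    have : sSup {c | ∃ y z, y ≠ z ∧ c = |f y - f z| / dist y z} ≤ C - |f x| := by
      refine Real.sSup_le ?_ (sub_nonneg.2 (h0 x))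
      rintro _ ⟨y, z, -, rfl⟩
      linarith [h x y z]
    linarith
  have := ciSup_le hsup
  unfold lipNorm
  linarith

lemma LipWrt.continuous {f : X → ℝ} (hf : LipWrt dist f) : Continuous f := by
  obtain ⟨K, hK⟩ := hf
  exact (LipschitzWith.of_dist_le' (K := K) fun x y => by
    simpa [Real.dist_eq] using hK x y).continuous

lemma abs_add_div_dist_le_lipNorm [CompactSpace X] {f : X → ℝ} (hf : LipWrt dist f) (x y z : X) :
    |f x| + |f y - f z| / dist y z ≤ lipNorm dist f := by
  refine add_le_add
    (le_ciSup (f := fun x => |f x|) (isCompact_range hf.continuous.abs).bddAbove x) ?_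
  obtain rfl | hyz := eq_or_ne y z
  · simp only [sub_self, abs_zero, zero_div]
    refine Real.sSup_nonneg ?_
    rintro _ ⟨y, z, -, rfl⟩
    positivity
  · obtain ⟨K, hK⟩ := hf
    refine le_csSup ⟨K, ?_⟩ ⟨y, z, hyz, rfl⟩
    rintro _ ⟨y, z, hne, rfl⟩
    exact (div_le_iff₀ (dist_pos.2 hne)).2 (hK y z)

lemma abs_sub_le_of_mem_lipNormBall {C : ℝ} {f : X →ᵇ ℝ} (hf : f ∈ lipNormBall X C) (x y : X) :
    |f x - f y| ≤ C * dist x y := by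
  obtain rfl | hxy := eq_or_ne x y
  · simp
  · refine (div_le_iff₀ (dist_pos.2 hxy)).1 ?_
    linarith [hf x x y, abs_nonneg (f x)]

lemma lipWrt_of_mem_lipNormBall {C : ℝ} {f : X →ᵇ ℝ} (hf : f ∈ lipNormBall X C) :
    LipWrt dist f :=
  ⟨C, abs_sub_le_of_mem_lipNormBall hf⟩

lemma smul_mem_lipNormBall {f : X →ᵇ ℝ} {C a : ℝ} (ha : 0 ≤ a) (hf : f ∈ lipNormBall X C) :
    a • f ∈ lipNormBall X (a * C) := by
  intro x y z
  have h := mul_le_mul_of_nonneg_left (hf x y z) ha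
  simp only [BoundedContinuousFunction.coe_smul, smul_eq_mul, ← mul_sub, abs_mul,
    abs_of_nonneg ha]
  rwa [mul_div_assoc, ← mul_add]

lemma convex_lipNormBall (C : ℝ) : Convex ℝ (lipNormBall X C) := by
  intro f hf g hg a b ha hb hab x y z
  have h₁ := smul_mem_lipNormBall ha hf x y z
  have h₂ := smul_mem_lipNormBall hb hg x y z
  have h₃ := abs_add_le ((a • f) x) ((b • g) x)
  have h₄ := div_le_div_of_nonneg_right (abs_add_le ((a • f) y - (a • f) z)
    ((b • g) y - (b • g) z)) (dist_nonneg (x := y) (y := z))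
  rw [add_div, ← add_sub_add_comm] at h₄
  have h₅ : a * C + b * C = C := by rw [← add_mul, hab, one_mul]
  simp only [BoundedContinuousFunction.coe_add, Pi.add_apply]
  linarith

lemma isCompact_lipNormBall [CompactSpace X] (C : ℝ) : IsCompact (lipNormBall X C) := by
  refine arzela_ascoli₂ (Icc (-C) C) isCompact_Icc _ ?_ ?_ ?_
  · simp only [lipNormBall, Set.ofPred_forall]
    refine isClosed_iInter fun x => isClosed_iInter fun y => isClosed_iInter fun z => ?_
    have hc : ∀ x : X, Continuous fun f : X →ᵇ ℝ => f x := fun x => continuous_eval_const x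
    exact isClosed_le ((hc x).abs.add (((hc y).sub (hc z)).abs.div_const _)) continuous_const
  · intro f x hf
    exact abs_le.1 (by simpa using hf x x x)
  · refine Metric.equicontinuous_of_continuity_modulus (fun t => C * t) ?_ _ ?_
    · simpa using (continuous_const_mul C).tendsto 0
    · rintro x y ⟨f, hf⟩
      exact abs_sub_le_of_mem_lipNormBall hf x y

lemma zero_mem_lipNormBall {C : ℝ} (hC : 0 ≤ C) : (0 : X →ᵇ ℝ) ∈ lipNormBall X C := by
  intro x y z
  simpa using hC

lemma lipNorm_zero [Nonempty X] : lipNorm dist (0 : X → ℝ) ≤ 0 :=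
  lipNorm_le_of_forall (by simp)

lemma KRdist_nonneg [Nonempty X] [MeasurableSpace X] (μ ν : ProbabilityMeasure X) :
    0 ≤ KRdist dist μ ν := by
  unfold KRdist
  refine Real.sSup_nonneg' ⟨0, ⟨0, ⟨0, by simp⟩, lipNorm_zero.trans zero_le_one, by simp⟩, le_rfl⟩

lemma KRdistSet_le_KRdist [Nonempty X] [MeasurableSpace X] (μ : ProbabilityMeasure X)
    {M : Set (ProbabilityMeasure X)} {ν : ProbabilityMeasure X} (hν : ν ∈ M) :
    KRdistSet dist μ M ≤ KRdist dist μ ν := by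
  refine csInf_le ⟨0, ?_⟩ ⟨ν, hν, rfl⟩
  rintro _ ⟨ν, -, rfl⟩
  exact KRdist_nonneg μ ν

lemma exists_mem_lipNormBall_of_lt_KRdist [Nonempty X] [CompactSpace X] [MeasurableSpace X]
    {μ ν : ProbabilityMeasure X} {t : ℝ} (ht : t < KRdist dist μ ν) :
    ∃ f ∈ lipNormBall X 1,
      t < (∫ x, f x ∂(ν : Measure X)) - ∫ x, f x ∂(μ : Measure X) := by
  obtain ⟨_, ⟨f, hf, hf1, rfl⟩, hlt⟩ := exists_lt_of_lt_csSup
    (⟨0, 0, ⟨0, by simp⟩, lipNorm_zero.trans zero_le_one, by simp⟩ :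
      {c | ∃ f : X → ℝ, LipWrt dist f ∧ lipNorm dist f ≤ 1 ∧
        c = (∫ x, f x ∂(μ : Measure X)) - ∫ x, f x ∂(ν : Measure X)}.Nonempty) ht
  refine ⟨-BoundedContinuousFunction.mkOfCompact ⟨f, hf.continuous⟩, fun x y z => ?_, ?_⟩
  · have h := (abs_add_div_dist_le_lipNorm hf x z y).trans hf1
    rw [dist_comm] at h
    simpa [neg_add_eq_sub] using h
  · simp only [BoundedContinuousFunction.coe_neg, Pi.neg_apply,
      BoundedContinuousFunction.mkOfCompact_apply, ContinuousMap.coe_mk, integral_neg]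
    linarith

end KantorovichRubinstein

end

/-- Lemma 5.2 of the paper, separation: if `M ⊆ P(X)` is convex nonempty
and `r := D^ρ(μ₀, M) > r₀ > 0`, there is a Lipschitz function `f` with `‖f‖_ρ < r − r₀` and
`inf_{ν ∈ M} E_ν[f] − E_{μ₀}[f] > ½(r − r₀)·r`. -/
theorem statement13 {X : Type*} [MetricSpace X] [CompactSpace X]
    [MeasurableSpace X] [BorelSpace X]
    (M : Set (ProbabilityMeasure X)) (hne : M.Nonempty) (hconv : ConvexPM M)
    (r₀ : ℝ) (hr₀ : 0 < r₀) (μ₀ : ProbabilityMeasure X)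
    (hr : r₀ < KRdistSet dist μ₀ M) :
    ∃ f : X → ℝ, LipWrt dist f ∧ lipNorm dist f < KRdistSet dist μ₀ M - r₀ ∧
      (1/2) * (KRdistSet dist μ₀ M - r₀) * KRdistSet dist μ₀ M <
        sInf {c : ℝ | ∃ ν ∈ M, c = ∫ x, f x ∂(ν : Measure X)} -
          ∫ x, f x ∂(μ₀ : Measure X) := by
  have : Nonempty X := (μ₀ : Measure X).nonempty_of_neZero
  set r := KRdistSet dist μ₀ M
  obtain ⟨f, hf, hfM⟩ := exists_forall_le_apply_of_forall_exists_le
    ⟨0, zero_mem_lipNormBall zero_le_one⟩ (convex_lipNormBall (X := X) 1)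
    (isCompact_lipNormBall 1) (hconv.convex_image_integralBCF.translate (-integralBCF μ₀))
    (t := 3 / 4 * r) (by
      rintro _ ⟨_, ⟨ν, hν, rfl⟩, rfl⟩
      obtain ⟨f, hf, hlt⟩ := exists_mem_lipNormBall_of_lt_KRdist
        (show 3 / 4 * r < KRdist dist μ₀ ν by linarith [KRdistSet_le_KRdist μ₀ hν])
      refine ⟨f, hf, ?_⟩
      simp only [_root_.add_apply, _root_.neg_apply, integralBCF_apply]
      linarith)
  have hpos : 0 < r - r₀ := sub_pos.2 hr
  have hmem := smul_mem_lipNormBall (a := 3 / 4 * (r - r₀)) (by positivity) hf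
  refine ⟨_, lipWrt_of_mem_lipNormBall hmem,
    (lipNorm_le_of_forall hmem).trans_lt (by linarith), ?_⟩
  have hinf : 3 / 4 * (r - r₀) * (3 / 4 * r + ∫ x, f x ∂(μ₀ : Measure X)) ≤
      sInf {c : ℝ | ∃ ν ∈ M, c = ∫ x, (3 / 4 * (r - r₀)) • f x ∂(ν : Measure X)} := by
    obtain ⟨ν₀, hν₀⟩ := hne
    refine le_csInf ⟨_, ν₀, hν₀, rfl⟩ ?_
    rintro _ ⟨ν, hν, rfl⟩
    rw [integral_smul, smul_eq_mul]
    refine mul_le_mul_of_nonneg_left ?_ (by positivity)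
    have h := hfM _ ⟨_, ⟨ν, hν, rfl⟩, rfl⟩
    simp only [_root_.add_apply, _root_.neg_apply, integralBCF_apply] at h
    linarith
  simp only [BoundedContinuousFunction.coe_smul]
  rw [integral_smul, smul_eq_mul]
  nlinarith [mul_pos hpos (hr₀.trans hr)]
end

section
/- Let M ⊆ P(O^ω), let (M_n)_{n∈ℕ} with M_n : O^n → 2^{P(O^ω)} a regular upper bound for M|pr_n for each n, and let ε > 0. Let S be a gambling strategy such that for each n and y ∈ O^n, S_n(y) is (M_n(y), ε)-savvy with respect to the metric ρ_n. Then S is μ*-prudent for every μ* ∈ M. -/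
open MeasureTheory Filter Set Topology
open scoped NNReal ENNReal

noncomputable section

variable (O : ℕ → Type*) [∀ n, TopologicalSpace (O n)] [∀ n, CompactSpace (O n)]
  [∀ n, PolishSpace (O n)] [∀ n, MeasurableSpace (O n)] [∀ n, BorelSpace (O n)]

/-- Proposition 5.1 of the paper: a gambling strategy whose bets are
`(M_n(y), ε)`-savvy with respect to `ρ_n`, where `M_n` is a regular upper bound for
`M | pr_n`, is `μ*`-prudent for every `μ* ∈ M`. -/
theorem statement17 (ρ : ℕ → Hw O → Hw O → ℝ) (hρ : ∀ n, IsMetrization (ρ n))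
    (M : Set (ProbabilityMeasure (Hw O)))
    (N : ∀ n : ℕ, Hn O n → Set (ProbabilityMeasure (Hw O)))
    (hN : ∀ n, IsRUB (proj O n) M (N n))
    (ε : ℝ) (hε : 0 < ε) (S : Strategy O)
    (hS : ∀ n y, IsSavvy (ρ n) (N n y) ε (fun p => S.S n y p)) :
    ∀ μstar ∈ M, IsPrudent O S μstar := by
  intro μstar hμ
  refine ⟨ε / 4, by positivity, fun n κ hκ => ?_⟩
  filter_upwards [(hN n).cond μstar hμ κ hκ] with y hy μ
  obtain ⟨hb, hgain⟩ := (hS n y).2 μ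
  have hgain := hgain (κ y) hy
  set r := KRdistSet (ρ n) μ (N n y)
  have hB : 0 ≤ max (r - ε) 0 := le_max_right _ _
  have hsup : sSup ((fun x => S.S n y (μ, x)) '' cyl O n y) ≤ max (r - ε) 0 := by
    refine Real.sSup_le ?_ hB
    rintro _ ⟨x, -, rfl⟩
    exact (abs_le.mp (hb x)).2
  have hinf : -max (r - ε) 0 ≤ sInf ((fun x => S.S n y (μ, x)) '' cyl O n y) := by
    refine Real.le_sInf ?_ (by linarith)
    rintro _ ⟨x, -, rfl⟩
    exact (abs_le.mp (hb x)).1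
  rcases le_total r ε with h | h
  · rw [max_eq_right (by linarith)] at hsup hinf hb
    have h0 : ∀ x, S.S n y (μ, x) = 0 := fun x => abs_nonpos_iff.mp (hb x)
    simp only [h0, integral_zero, sub_self] at hsup hinf ⊢
    exact mul_nonpos_of_nonneg_of_nonpos (by positivity) (by linarith)
  · rw [max_eq_left (by linarith)] at hsup hinf
    refine le_trans ?_ hgain
    nlinarith [mul_nonneg (sub_nonneg.mpr h) (sub_nonneg.mpr h)]

end
end
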